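/- arXiv:2306.05549 — 4 statements merged into one kernel-verified Lean document; each statement's English description precedes it below -/
import Mathlib

section
/- Let N ≥ 2 be an even integer, k = N/2, and let f : [0,1) → [0,∞) be continuous with f(0) = 0 and f(r) > 0 for r ∈ (0,1), satisfying limsup_{r→0⁺} f(r)·|ln r|^σ < ∞ for some σ > 1. Then for every β > 0 and every v ∈ X_1, the integral ∫₀¹ r^{N−1} exp(β |v(r)|^{(N+2)/N + f(r)}) dr is finite. -/
open MeasureTheory Real Set Filter
open scoped ENNReal

/-- Surface area of the unit sphere in `ℝ^N` (equals `N` times the volume of the unit ball). -/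
noncomputable def omegaS (N : ℕ) : ℝ :=
  N * (volume (Metric.ball (0 : EuclideanSpace ℝ (Fin N)) 1)).toReal

/-- The normalising constant `c_N = ω_{N-1} · binom(N,k) / N`. -/
noncomputable def cN (N k : ℕ) : ℝ := omegaS N * (N.choose k) / N

/-- The critical constant `μ_N = N · (ω_{N-1} · binom(N-1,k-1) / k)^{2/N}`. -/
noncomputable def muN (N k : ℕ) : ℝ :=
  N * (omegaS N * ((N - 1).choose (k - 1)) / k) ^ ((2 : ℝ) / N)

/-- Membership in the weighted space `X₁`: `v` is locally absolutely continuous on `(0,1)`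
with derivative `v'` (in the sense of the fundamental theorem of calculus),
`v(r) → 0` as `r → 1⁻`, and the two defining weighted integrals are finite. -/
structure MemX1 (N k : ℕ) (v v' : ℝ → ℝ) : Prop where
  locAC : ∀ a ∈ Ioo (0:ℝ) 1, ∀ b ∈ Ioo (0:ℝ) 1,
    IntervalIntegrable v' volume a b ∧ v b - v a = ∫ t in a..b, v' t
  lim_one : Tendsto v (nhdsWithin 1 (Iio 1)) (nhds 0)
  grad_int : ∫⁻ r in Ioo (0:ℝ) 1, ENNReal.ofReal (r ^ (N - k) * |v' r| ^ (k + 1)) < ⊤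
  fun_int : ∫⁻ r in Ioo (0:ℝ) 1, ENNReal.ofReal (r ^ (N - 1) * |v r| ^ (k + 1)) < ⊤

/-- The norm on `X₁`: `‖v‖ = (c_N ∫₀¹ r^{N-k} |v'|^{k+1} dr)^{1/(k+1)}`. -/
noncomputable def normX1 (N k : ℕ) (v' : ℝ → ℝ) : ℝ :=
  (cN N k * ∫ r in Ioo (0:ℝ) 1, r ^ (N - k) * |v' r| ^ (k + 1)) ^ (1 / (k + 1 : ℝ))

/-- The supercritical Trudinger–Moser integral `∫₀¹ r^{N-1} exp(β |v|^{(N+2)/N + f(r)}) dr`. -/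
noncomputable def mtIntegral (N : ℕ) (β : ℝ) (f v : ℝ → ℝ) : ℝ≥0∞ :=
  ∫⁻ r in Ioo (0:ℝ) 1,
    ENNReal.ofReal (r ^ (N - 1) * exp (β * |v r| ^ (((N : ℝ) + 2) / N + f r)))

/-- An elementary Young-type inequality with a free weight `s`. -/
lemma le_add_pow_succ_div (k : ℕ) {x s : ℝ} (hx : 0 ≤ x) (hs : 0 < s) :
    x ≤ s + x ^ (k + 1) / s ^ k := by
  rcases le_total x s with h | h
  · have : 0 ≤ x ^ (k + 1) / s ^ k := by positivity
    linarith
  · have : x ≤ x ^ (k + 1) / s ^ k := by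
      rw [le_div_iff₀ (by positivity), pow_succ']
      exact mul_le_mul_of_nonneg_left (pow_le_pow_left₀ hs.le h k) hx
    linarith

/-- Weighted oscillation bound for an absolutely continuous function on `[r, b]`. -/
lemma abs_intervalIntegral_le_log_add (k : ℕ) {w : ℝ → ℝ} {r b c E : ℝ} (hr : 0 < r) (hrb : r ≤ b)
    (hc : 0 < c) (hw : IntervalIntegrable w volume r b) (hE : 0 ≤ E)
    (hwE : ∫⁻ t in Ioc r b, ENNReal.ofReal (t ^ k * |w t| ^ (k + 1)) ≤ ENNReal.ofReal E) :
    |∫ t in r..b, w t| ≤ c * log (b / r) + E / c ^ k := by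
  have hnn : 0 ≤ᵐ[volume.restrict (Ioc r b)] fun t => t ^ k * |w t| ^ (k + 1) := by
    filter_upwards [ae_restrict_mem measurableSet_Ioc] with t ht
    have : 0 < t := hr.trans ht.1
    simp only [Pi.zero_apply]
    positivity
  have hmeas : AEStronglyMeasurable (fun t => t ^ k * |w t| ^ (k + 1))
      (volume.restrict (Ioc r b)) := by
    have h1 : AEStronglyMeasurable w (volume.restrict (Ioc r b)) := hw.1.aestronglyMeasurable
    exact (continuous_pow k).aestronglyMeasurable.mul (h1.norm.pow (k + 1))
  have hint : IntegrableOn (fun t => t ^ k * |w t| ^ (k + 1)) (Ioc r b) :=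
    ⟨hmeas, (hasFiniteIntegral_iff_ofReal hnn).2 (hwE.trans_lt ENNReal.ofReal_lt_top)⟩
  have hle : ∫ t in r..b, t ^ k * |w t| ^ (k + 1) ≤ E := by
    rw [intervalIntegral.integral_of_le hrb, integral_eq_lintegral_of_nonneg_ae hnn hmeas]
    exact ENNReal.toReal_le_of_le_ofReal hE hwE
  have hgi : IntervalIntegrable (fun t => t ^ k * |w t| ^ (k + 1)) volume r b :=
    (intervalIntegrable_iff_integrableOn_Ioc_of_le hrb).2 hint
  have hinv : IntervalIntegrable (fun t : ℝ => t⁻¹) volume r b := by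
    refine intervalIntegral.intervalIntegrable_inv (fun t ht => ?_) continuousOn_id
    rw [uIcc_of_le hrb] at ht
    exact (hr.trans_le ht.1).ne'
  calc |∫ t in r..b, w t| ≤ ∫ t in r..b, |w t| :=
        intervalIntegral.abs_integral_le_integral_abs hrb
    _ ≤ ∫ t in r..b, (c * t⁻¹ + (t ^ k * |w t| ^ (k + 1)) / c ^ k) := by
        refine intervalIntegral.integral_mono_on hrb hw.abs
          ((hinv.const_mul c).add (hgi.div_const _)) fun t ht => ?_
        have ht0 : 0 < t := hr.trans_le ht.1
        have h := le_add_pow_succ_div k (abs_nonneg (w t)) (s := c * t⁻¹) (by positivity)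
        refine h.trans (le_of_eq ?_)
        rw [mul_pow, inv_pow]
        field_simp
    _ = c * log (b / r) + (∫ t in r..b, t ^ k * |w t| ^ (k + 1)) / c ^ k := by
        rw [intervalIntegral.integral_add (hinv.const_mul c) (hgi.div_const _),
          intervalIntegral.integral_const_mul, intervalIntegral.integral_div,
          integral_inv_of_pos hr (hr.trans_le hrb)]
    _ ≤ c * log (b / r) + E / c ^ k := by gcongr

/-- Strauss-type decay: functions in `X₁` are `o(|log r|^{k/(k+1)})` at the origin. -/
lemma MemX1.eventually_abs_le {N k : ℕ} (hk : 0 < k) (hN : N = 2 * k) {v v' : ℝ → ℝ}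
    (hv : MemX1 N k v v') {η : ℝ} (hη : 0 < η) :
    ∀ᶠ r in nhdsWithin (0:ℝ) (Ioi 0), |v r| ≤ 3 * η * (-log r) ^ ((k : ℝ) / (k + 1)) := by
  have hNk : N - k = k := by omega
  have hfin := hv.grad_int
  rw [hNk] at hfin
  obtain ⟨δ, hδ, hδs⟩ := exists_pos_setLIntegral_lt_of_measure_lt hfin.ne
    (ε := ENNReal.ofReal (η ^ (k + 1))) (by simp; positivity)
  obtain ⟨b, hb0, hb1, hbδ⟩ : ∃ b : ℝ, 0 < b ∧ b < 1 ∧ ENNReal.ofReal b < δ := by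
    rcases ENNReal.lt_iff_exists_real_btwn.1 hδ with ⟨x, _, hx0, hxδ⟩
    have hx : 0 < x := by simpa using hx0
    exact ⟨min x (1 / 2), by positivity, (min_le_right _ _).trans_lt (by norm_num),
      (ENNReal.ofReal_le_ofReal (min_le_left _ _)).trans_lt hxδ⟩
  have hsmall : ∫⁻ t in Ioc 0 b, ENNReal.ofReal (t ^ k * |v' t| ^ (k + 1))
      ≤ ENNReal.ofReal (η ^ (k + 1)) := by
    have h := hδs (Ioc 0 b) ((Measure.restrict_apply_le _ _).trans_lt (by simpa using hbδ))
    rw [Measure.restrict_restrict measurableSet_Ioc,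
      inter_eq_left.2 (show Ioc 0 b ⊆ Ioo 0 1 from fun t ht => ⟨ht.1, ht.2.trans_lt hb1⟩)] at h
    exact h.le
  have hlog : Tendsto (fun r => -log r) (nhdsWithin (0:ℝ) (Ioi 0)) atTop :=
    tendsto_neg_atBot_atTop.comp Real.tendsto_log_nhdsGT_zero
  have hk1 : (0:ℝ) < (k : ℝ) / (k + 1) := by positivity
  have hpow := ((tendsto_rpow_atTop hk1).comp hlog).const_mul_atTop hη
  filter_upwards [hlog.eventually_ge_atTop 1, hpow.eventually_ge_atTop |v b|,
    Ioo_mem_nhdsGT hb0] with r hL hvb hr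
  simp only [Function.comp_apply] at hvb
  obtain ⟨hint, heq⟩ := hv.locAC r ⟨hr.1, hr.2.trans hb1⟩ b ⟨hb0, hb1⟩
  set L := -log r with hLdef
  have hL0 : 0 < L := by linarith
  have hc : 0 < η * L ^ (-(1 : ℝ) / (k + 1)) := by positivity
  have key := abs_intervalIntegral_le_log_add k hr.1 hr.2.le hc hint
    (E := η ^ (k + 1)) (by positivity)
    ((lintegral_mono_set (Ioc_subset_Ioc_left hr.1.le)).trans hsmall)
  rw [← heq] at key
  have hlogle : log (b / r) ≤ L := by
    rw [log_div hb0.ne' hr.1.ne', hLdef]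
    linarith [log_neg hb0 hb1]
  have e1 : η * L ^ (-(1 : ℝ) / (k + 1)) * L = η * L ^ ((k : ℝ) / (k + 1)) := by
    rw [mul_assoc, ← rpow_add_one hL0.ne']
    congr 2
    field_simp
    ring
  have e2 : η ^ (k + 1) / (η * L ^ (-(1 : ℝ) / (k + 1))) ^ k = η * L ^ ((k : ℝ) / (k + 1)) := by
    rw [mul_pow, ← rpow_natCast (L ^ _), ← rpow_mul hL0.le,
      show -(1 : ℝ) / (k + 1) * k = -((k : ℝ) / (k + 1)) by ring, rpow_neg hL0.le]
    field_simp
    ring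
  have h3 := mul_le_mul_of_nonneg_left hlogle hc.le
  have h4 : |v r| ≤ |v b| + |v b - v r| := by
    have := abs_sub_abs_le_abs_sub (v r) (v b)
    rw [abs_sub_comm] at this
    linarith
  rw [e2] at key
  rw [e1] at h3
  linarith

/-- The exponent `β |v|^{(N+2)/N + f}` is dominated by `-log r` near the origin. -/
lemma MemX1.eventually_mul_rpow_le {N k : ℕ} (hk : 0 < k) (hN : N = 2 * k) {f v v' : ℝ → ℝ}
    (hfnn : ∀ r ∈ Ico (0:ℝ) 1, 0 ≤ f r) {σ : ℝ} (hσ : 1 < σ)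
    (hbd : IsBoundedUnder (· ≤ ·) (nhdsWithin (0:ℝ) (Ioi 0)) (fun r => f r * |log r| ^ σ))
    {β : ℝ} (hβ : 0 < β) (hv : MemX1 N k v v') :
    ∀ᶠ r in nhdsWithin (0:ℝ) (Ioi 0), β * |v r| ^ (((N : ℝ) + 2) / N + f r) ≤ -log r := by
  obtain ⟨C, hC⟩ := hbd
  rw [eventually_map] at hC
  have hk0 : (0:ℝ) < k := by exact_mod_cast hk
  have hα : ((N : ℝ) + 2) / N = ((k : ℝ) + 1) / k := by
    rw [hN]; push_cast; field_simp
  set ε : ℝ := min 1 (β * exp |C|)⁻¹ with hε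
  have hε0 : 0 < ε := by positivity
  have hlog : Tendsto (fun r => -log r) (nhdsWithin (0:ℝ) (Ioi 0)) atTop :=
    tendsto_neg_atBot_atTop.comp Real.tendsto_log_nhdsGT_zero
  filter_upwards [hv.eventually_abs_le hk hN (η := ε / 3) (by positivity), hC,
    hlog.eventually_ge_atTop 1, hlog.eventually_ge_atTop β,
    Ioo_mem_nhdsGT (zero_lt_one (α := ℝ))] with r hvr hfr hL hLβ hr
  have hf := hfnn r ⟨hr.1.le, hr.2⟩
  rw [abs_of_neg (log_neg hr.1 hr.2)] at hfr
  set L := -log r with hLdef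
  have hL0 : 0 < L := by linarith
  have hα0 : 0 < ((k : ℝ) + 1) / k := by positivity
  rw [hα]
  rw [show 3 * (ε / 3) = ε by ring] at hvr
  rcases le_total |v r| 1 with h1 | h1
  · have : |v r| ^ (((k : ℝ) + 1) / k + f r) ≤ 1 := rpow_le_one (abs_nonneg _) h1 (by positivity)
    nlinarith
  · have hv0 : 0 < |v r| := by linarith
    have hvL : |v r| ≤ L := by
      refine hvr.trans ?_
      have : L ^ ((k : ℝ) / (k + 1)) ≤ L := by
        conv_rhs => rw [← rpow_one L]
        exact rpow_le_rpow_of_exponent_le hL (by rw [div_le_one (by positivity)]; linarith)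
      have h2 : ε ≤ 1 := min_le_left _ _
      have h3 : 0 ≤ L ^ ((k : ℝ) / (k + 1)) := by positivity
      nlinarith
    have hvf : |v r| ^ f r ≤ exp |C| := by
      refine (rpow_le_rpow hv0.le hvL hf).trans ?_
      rw [rpow_def_of_pos hL0, exp_le_exp]
      have h2 : log L ≤ L ^ σ := by
        refine (log_le_self hL0.le).trans ?_
        conv_lhs => rw [← rpow_one L]
        exact rpow_le_rpow_of_exponent_le hL hσ.le
      calc log L * f r ≤ L ^ σ * f r := by gcongr
        _ ≤ |C| := by rw [mul_comm]; exact hfr.trans (le_abs_self C)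
    have hvα : |v r| ^ (((k : ℝ) + 1) / k) ≤ ε * L := by
      refine (rpow_le_rpow hv0.le hvr hα0.le).trans ?_
      rw [mul_rpow hε0.le (by positivity), ← rpow_mul hL0.le,
        show (k : ℝ) / (k + 1) * ((k + 1) / k) = 1 by field_simp, rpow_one]
      gcongr
      conv_rhs => rw [← rpow_one ε]
      exact rpow_le_rpow_of_exponent_ge hε0 (min_le_left _ _)
        (by rw [le_div_iff₀ hk0]; linarith)
    rw [rpow_add hv0]
    have hεC : ε * (β * exp |C|) ≤ 1 :=
      (mul_le_mul_of_nonneg_right (min_le_right _ _) (by positivity)).trans_eq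
        (inv_mul_cancel₀ (by positivity))
    calc β * (|v r| ^ (((k : ℝ) + 1) / k) * |v r| ^ f r)
        ≤ β * ((ε * L) * exp |C|) := by gcongr
      _ = (ε * (β * exp |C|)) * L := by ring
      _ ≤ L := mul_le_of_le_one_left hL0.le hεC

/-- Functions in `X₁` are bounded on compact subintervals of `(0,1)`. -/
lemma MemX1.exists_abs_le {N k : ℕ} {v v' : ℝ → ℝ} (hv : MemX1 N k v v') {a b : ℝ}
    (ha : 0 < a) (hab : a ≤ b) (hb : b < 1) : ∃ M, ∀ r ∈ Icc a b, |v r| ≤ M := by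
  have ha' : a ∈ Ioo (0:ℝ) 1 := ⟨ha, hab.trans_lt hb⟩
  have hcont : ContinuousOn v (Icc a b) := by
    have h := intervalIntegral.continuousOn_primitive_interval
      ((intervalIntegrable_iff' (by simp)).1 (hv.locAC a ha' b ⟨ha.trans_le hab, hb⟩).1)
    rw [uIcc_of_le hab] at h
    refine (h.add (continuousOn_const (c := v a))).congr fun r hr => ?_
    have := (hv.locAC a ha' r ⟨ha.trans_le hr.1, hr.2.trans_lt hb⟩).2
    change v r = (∫ t in a..r, v' t) + v a
    linarith
  exact isCompact_Icc.exists_bound_of_continuousOn hcont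

theorem stmt4 (N k : ℕ) (hk : 0 < k) (hN : N = 2 * k)
    (f : ℝ → ℝ) (hfc : ContinuousOn f (Ico 0 1)) (hf0 : f 0 = 0)
    (hfpos : ∀ r ∈ Ioo (0:ℝ) 1, 0 < f r) (hfnn : ∀ r ∈ Ico (0:ℝ) 1, 0 ≤ f r)
    (hσ : ∃ σ : ℝ, 1 < σ ∧ IsBoundedUnder (· ≤ ·) (nhdsWithin (0:ℝ) (Ioi 0))
      (fun r => f r * |log r| ^ σ))
    (β : ℝ) (hβ : 0 < β) (v v' : ℝ → ℝ) (hv : MemX1 N k v v') :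
    mtIntegral N β f v < ⊤ := by
  obtain ⟨σ, hσ1, hbd⟩ := hσ
  have hNpos : 0 < N := by omega
  suffices h : ∃ K : ℝ, ∀ r ∈ Ioo (0:ℝ) 1,
      r ^ (N - 1) * exp (β * |v r| ^ (((N : ℝ) + 2) / N + f r)) ≤ K by
    obtain ⟨K, hK⟩ := h
    refine (setLIntegral_mono measurable_const
      fun r hr => ENNReal.ofReal_le_ofReal (hK r hr)).trans_lt ?_
    simp
  obtain ⟨a, ha0, hA⟩ := mem_nhdsGT_iff_exists_Ioo_subset.1
    (hv.eventually_mul_rpow_le hk hN hfnn hσ1 hbd hβ)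
  have hnear1 : ∀ᶠ r in nhdsWithin (1:ℝ) (Iio 1), |v r| ≤ 1 := by
    have h := hv.lim_one.abs
    rw [abs_zero] at h
    exact h.eventually_le_const zero_lt_one
  obtain ⟨b, hb1, hB⟩ := mem_nhdsLT_iff_exists_Ioo_subset.1 hnear1
  have ha0' : 0 < a := ha0
  have hb1' : b < 1 := hb1
  obtain ⟨a', ha'0, ha'1, ha'a⟩ : ∃ a' : ℝ, 0 < a' ∧ a' ≤ 1 / 2 ∧ a' ≤ a :=
    ⟨min a (1 / 2), by positivity, min_le_right _ _, min_le_left _ _⟩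
  obtain ⟨b', hb'0, hb'1, hbb'⟩ : ∃ b' : ℝ, 1 / 2 ≤ b' ∧ b' < 1 ∧ b ≤ b' :=
    ⟨max b (1 / 2), le_max_right _ _, max_lt hb1' (by norm_num), le_max_left _ _⟩
  obtain ⟨M, hM⟩ := hv.exists_abs_le ha'0 (ha'1.trans hb'0) hb'1
  obtain ⟨F, hF⟩ := isCompact_Icc.exists_bound_of_continuousOn
    (hfc.mono (Icc_subset_Ico_right hb'1 |>.trans (Ico_subset_Ico_left ha'0.le)))
  set R := exp (β * (max 1 M) ^ (((N : ℝ) + 2) / N + F)) with hR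
  refine ⟨max 1 (max (exp β) R), fun r hr => ?_⟩
  have hfr := hfnn r ⟨hr.1.le, hr.2⟩
  have hpow1 : r ^ (N - 1) ≤ 1 := pow_le_one₀ hr.1.le hr.2.le
  have hdrop : r ^ (N - 1) * exp (β * |v r| ^ (((N : ℝ) + 2) / N + f r))
      ≤ exp (β * |v r| ^ (((N : ℝ) + 2) / N + f r)) :=
    mul_le_of_le_one_left (exp_pos _).le hpow1
  rcases lt_or_ge r a' with h1 | h1
  · refine le_trans ?_ (le_max_left _ _)
    have h2 : β * |v r| ^ (((N : ℝ) + 2) / N + f r) ≤ -log r := hA ⟨hr.1, h1.trans_le ha'a⟩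
    calc r ^ (N - 1) * exp (β * |v r| ^ (((N : ℝ) + 2) / N + f r))
        ≤ r ^ 1 * exp (-log r) :=
          mul_le_mul (pow_le_pow_of_le_one hr.1.le hr.2.le (by omega)) (exp_le_exp.2 h2)
            (exp_pos _).le (by simpa using hr.1.le)
      _ = 1 := by rw [exp_neg, exp_log hr.1, pow_one, mul_inv_cancel₀ hr.1.ne']
  refine hdrop.trans (le_trans ?_ (le_max_right _ _))
  rcases lt_or_ge b' r with h2 | h2
  · refine le_trans (exp_le_exp.2 ?_) (le_max_left _ _)
    have h3 : |v r| ≤ 1 := hB ⟨hbb'.trans_lt h2, hr.2⟩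
    exact mul_le_of_le_one_right hβ.le (rpow_le_one (abs_nonneg _) h3 (by positivity))
  · refine le_trans (exp_le_exp.2 ?_) (le_max_right _ _)
    gcongr
    calc |v r| ^ (((N : ℝ) + 2) / N + f r)
        ≤ (max 1 M) ^ (((N : ℝ) + 2) / N + f r) :=
          rpow_le_rpow (abs_nonneg _) ((hM r ⟨h1, h2⟩).trans (le_max_right _ _)) (by positivity)
      _ ≤ (max 1 M) ^ (((N : ℝ) + 2) / N + F) := by
          refine rpow_le_rpow_of_exponent_le (le_max_left _ _) ?_
          linarith [(le_abs_self (f r)).trans (hF r ⟨h1, h2⟩)]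
end

section
/- Let N ≥ 2 be an even integer, k = N/2, and let f : [0,1) → [0,∞) be continuous with f(0) = 0 and f(r) > 0 for r ∈ (0,1), satisfying limsup_{r→0⁺} f(r)·|ln r|^σ < ∞ for some σ > 1. Then for every β with 0 < β ≤ μ_N, the supremum MT_N(f;β) = sup { ∫₀¹ r^{N−1} exp(β |v(r)|^{(N+2)/N + f(r)}) dr : v ∈ X_1, ‖v‖_{X_1} = 1 } is finite. -/
open MeasureTheory Real Set Filter
open scoped ENNReal

/-- Weighted convexity of `x ↦ x ^ p` for `p = (k + 1) / k`. -/
lemma add_rpow_le_weighted {p a b θ : ℝ} (hp : 1 ≤ p) (ha : 0 ≤ a) (hb : 0 ≤ b)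
    (hθ : 0 < θ) (hθ1 : θ < 1) :
    (a + b) ^ p ≤ (1 - θ) ^ (1 - p) * a ^ p + θ ^ (1 - p) * b ^ p := by
  have h1 : 0 < 1 - θ := by linarith
  have hmem1 : a / (1 - θ) ∈ Ici (0 : ℝ) := div_nonneg ha h1.le
  have hmem2 : b / θ ∈ Ici (0 : ℝ) := div_nonneg hb hθ.le
  have h := (convexOn_rpow hp).2 hmem1 hmem2 h1.le hθ.le (by ring)
  simp only [smul_eq_mul] at h
  rw [mul_div_cancel₀ _ h1.ne', mul_div_cancel₀ _ hθ.ne', div_rpow ha h1.le,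
    div_rpow hb hθ.le] at h
  rw [rpow_sub h1, rpow_sub hθ, rpow_one, rpow_one]
  calc _ ≤ _ := h
    _ = _ := by ring

/-- The gap estimate in Moser's inequality: two points of a sublevel set of `x - V ^ p`, both
beyond a multiple of the level `l`, are at distance at most a multiple of `l`. -/
lemma moser_gap {k : ℕ} (hk : 0 < k) {x s l A B g d : ℝ} (hl : 0 < l) (hs : 0 ≤ s)
    (hx : 2 ^ (k + 1) * k * l ≤ x) (hA : 0 ≤ A) (hB : 0 ≤ B) (hg : 0 ≤ g) (hd : 0 ≤ d)
    (hgd : g + d ≤ 1)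
    (hAg : A ≤ g ^ (1 / (k + 1 : ℝ)) * x ^ (k / (k + 1 : ℝ)))
    (hBA : B ≤ A + d ^ (1 / (k + 1 : ℝ)) * s ^ (k / (k + 1 : ℝ)))
    (hAl : x - l ≤ A ^ ((k + 1 : ℝ) / k)) (hBl : x + s - l ≤ B ^ ((k + 1 : ℝ) / k)) :
    s ≤ 2 * (1 + 2 ^ (k + 1) * k) * l := by
  have hk1 : (1 : ℝ) ≤ k := by exact_mod_cast hk
  have hk0 : (0 : ℝ) < k := by linarith
  have hx0 : 0 < x := lt_of_lt_of_le (by positivity) hx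
  have hlx : l ≤ x := by
    refine le_trans ?_ hx
    have h1 : (1 : ℝ) ≤ 2 ^ (k + 1) := one_le_pow₀ (by norm_num)
    nlinarith [mul_le_mul h1 hk1 (by norm_num) (by positivity)]
  have hpow : ∀ y z : ℝ, 0 ≤ y → 0 ≤ z →
      (y ^ (1 / (k + 1 : ℝ)) * z ^ (k / (k + 1 : ℝ))) ^ ((k + 1 : ℝ) / k)
        = y ^ (1 / (k : ℝ)) * z := by
    intro y z hy hz
    rw [mul_rpow (by positivity) (by positivity), ← rpow_mul hy, ← rpow_mul hz]
    congr 1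
    · congr 1; field_simp
    · have : (k : ℝ) / (k + 1) * ((k + 1) / k) = 1 := by field_simp
      rw [this, rpow_one]
  have hp1 : (1 : ℝ) ≤ (k + 1 : ℝ) / k := by
    rw [le_div_iff₀ hk0]; linarith
  have hp : (1 : ℝ) - (k + 1 : ℝ) / k = -(1 / k) := by field_simp; ring
  -- the mass beyond the first point is small
  have hg1 : 1 - k * l / x ≤ g := by
    have h1 : x - l ≤ g ^ (1 / (k : ℝ)) * x := by
      rw [← hpow g x hg hx0.le]
      exact hAl.trans (rpow_le_rpow hA hAg (by positivity))
    have h2 : 1 - l / x ≤ g ^ (1 / (k : ℝ)) := by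
      rw [← sub_nonneg] at h1 ⊢
      have : g ^ (1 / (k : ℝ)) - (1 - l / x) = (g ^ (1 / (k : ℝ)) * x - (x - l)) / x := by
        field_simp
      rw [this]; positivity
    have h3 : 0 ≤ 1 - l / x := by
      rw [sub_nonneg, div_le_one hx0]; exact hlx
    have h4 : (1 - l / x) ^ k ≤ g := by
      calc (1 - l / x) ^ k ≤ (g ^ (1 / (k : ℝ))) ^ k := pow_le_pow_left₀ h3 h2 k
        _ = g := by
          rw [← rpow_natCast, ← rpow_mul hg, one_div, inv_mul_cancel₀ hk0.ne', rpow_one]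
    have h5 := one_add_mul_le_pow (a := -(l / x)) (by linarith) k
    calc 1 - k * l / x = 1 + k * -(l / x) := by ring
      _ ≤ (1 + -(l / x)) ^ k := h5
      _ ≤ g := by rw [← sub_eq_add_neg]; exact h4
  set D : ℝ := k * l / x with hD
  have hD0 : 0 < D := by positivity
  have hdD : d ≤ D := by linarith
  set θ : ℝ := 2 ^ k * D with hθ
  have hθ0 : 0 < θ := by positivity
  have hθ2 : θ ≤ 1 / 2 := by
    rw [hθ, hD, ← mul_div_assoc, div_le_iff₀ hx0]
    rw [pow_succ] at hx
    linarith
  have hAx : A ≤ x ^ (k / (k + 1 : ℝ)) := by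
    refine hAg.trans (mul_le_of_le_one_left (by positivity) ?_)
    exact rpow_le_one hg (by linarith) (by positivity)
  have hB2 : B ≤ x ^ (k / (k + 1 : ℝ)) + D ^ (1 / (k + 1 : ℝ)) * s ^ (k / (k + 1 : ℝ)) := by
    refine hBA.trans (add_le_add hAx ?_)
    gcongr
  have hc := add_rpow_le_weighted (p := (k + 1 : ℝ) / k) (a := x ^ (k / (k + 1 : ℝ)))
    (b := D ^ (1 / (k + 1 : ℝ)) * s ^ (k / (k + 1 : ℝ))) hp1 (by positivity) (by positivity)
    hθ0 (by linarith)
  have hxx : (x ^ (k / (k + 1 : ℝ))) ^ ((k + 1 : ℝ) / k) = x := by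
    simpa using hpow 1 x zero_le_one hx0.le
  rw [hpow D s hD0.le hs, hxx, hp] at hc
  have hsecond : θ ^ (-(1 / (k : ℝ))) * (D ^ (1 / (k : ℝ)) * s) = s / 2 := by
    have h2 : ((2 : ℝ) ^ k) ^ (1 / (k : ℝ)) = 2 := by
      rw [← rpow_natCast, ← rpow_mul (by norm_num), mul_one_div_cancel hk0.ne', rpow_one]
    rw [hθ, rpow_neg (by positivity), mul_rpow (by positivity) hD0.le, h2]
    have : 0 < D ^ (1 / (k : ℝ)) := by positivity
    field_simp
  have hfirst : (1 - θ) ^ (-(1 / (k : ℝ))) ≤ 1 + 2 * θ := by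
    calc (1 - θ) ^ (-(1 / (k : ℝ))) ≤ (1 - θ) ^ (-1 : ℝ) := by
          apply rpow_le_rpow_of_exponent_ge (by linarith) (by linarith)
          rw [neg_le_neg_iff, div_le_one hk0]; exact hk1
      _ = (1 - θ)⁻¹ := rpow_neg_one _
      _ ≤ 1 + 2 * θ := by
          rw [inv_le_iff_one_le_mul₀ (by linarith)]
          nlinarith
  have hfin : x + s - l ≤ (1 + 2 * θ) * x + s / 2 := by
    refine (hBl.trans (rpow_le_rpow hB hB2 (by positivity))).trans (hc.trans ?_)
    rw [hsecond]
    gcongr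
  have hθx : θ * x = 2 ^ k * k * l := by
    rw [hθ, hD]; field_simp
  rw [pow_succ]
  nlinarith

/-- A nonnegative supercritical perturbation of the exponent that decays fast enough costs only
an additive constant. -/
lemma exists_supercritical_bound {f : ℝ → ℝ} (hfc : ContinuousOn f (Ico 0 1))
    (hfnn : ∀ r ∈ Ico (0:ℝ) 1, 0 ≤ f r) {σ : ℝ} (hσ : 1 < σ)
    (hfσ : IsBoundedUnder (· ≤ ·) (nhdsWithin (0:ℝ) (Ioi 0)) (fun r => f r * |log r| ^ σ))
    {β μ p K : ℝ} (hβ : 0 < β) (hβμ : β ≤ μ) (hp : 1 ≤ p) (hK : 0 < K) :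
    ∃ C : ℝ, ∀ r ∈ Ioo (0:ℝ) 1, ∀ y : ℝ, 0 ≤ y → y ^ p ≤ K * (-log r) →
      β * y ^ (p + f r) ≤ μ * y ^ p + C := by
  obtain ⟨b, hb⟩ := hfσ
  rw [eventually_map] at hb
  obtain ⟨r0, hr0, hr0b⟩ := mem_nhdsGT_iff_exists_Ioo_subset.1 hb
  have hr0' : (0:ℝ) < r0 := hr0
  set r1 : ℝ := exp (-(1 / K)) with hr1
  have hr1lt : r1 < 1 := by rw [hr1, exp_lt_one_iff]; simp [hK]
  have hcont : ContinuousOn (fun r => f r * |log r| ^ σ) (Icc r0 r1) := by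
    refine ContinuousOn.mul (hfc.mono fun x hx => ⟨by linarith [hx.1], by linarith [hx.2]⟩) ?_
    refine ContinuousOn.rpow_const ?_ (fun x _ => Or.inr (by linarith))
    exact (continuousOn_log.mono fun x hx => by
      have : 0 < x := by linarith [hx.1]
      simpa using this.ne').abs
  obtain ⟨b', hb'⟩ := (isCompact_Icc.image_of_continuousOn hcont).bddAbove
  set B : ℝ := max (max b b') 0 with hB
  have hB0 : 0 ≤ B := le_max_right _ _
  have hfB : ∀ r, 0 < r → r ≤ r1 → f r * |log r| ^ σ ≤ B := by
    intro r h0 h1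
    rcases lt_or_ge r r0 with h | h
    · exact (hr0b ⟨h0, h⟩ : f r * |log r| ^ σ ≤ b).trans
        ((le_max_left _ _).trans (le_max_left _ _))
    · exact (hb' ⟨r, ⟨h, h1⟩, rfl⟩).trans ((le_max_right _ _).trans (le_max_left _ _))
  set C2 : ℝ := B * K ^ σ / (σ - 1) with hC2
  have hσ1 : 0 < σ - 1 := by linarith
  have hC20 : 0 ≤ C2 := by positivity
  have hμ : 0 < μ := hβ.trans_le hβμ
  refine ⟨β + μ * (C2 * exp C2), fun r hr y hy hyK => ?_⟩
  have hf0 := hfnn r ⟨hr.1.le, hr.2⟩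
  rcases le_or_gt y 1 with hy1 | hy1
  · have h1 : y ^ (p + f r) ≤ 1 := rpow_le_one hy hy1 (by linarith)
    have h2 : 0 ≤ y ^ p := by positivity
    have h3 : 0 ≤ μ * y ^ p + μ * (C2 * exp C2) := by positivity
    nlinarith
  · set Z : ℝ := K * (-log r) with hZ
    have hy0 : 0 < y := by linarith
    have hyp1 : 1 < y ^ p := one_lt_rpow hy1 (by linarith)
    have hZ1 : 1 < Z := hyp1.trans_le hyK
    have hL : 1 / K < -log r := by
      rw [div_lt_iff₀ hK]; linarith
    have hL0 : 0 < -log r := lt_trans (by positivity) hL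
    have hrr1 : r ≤ r1 := by
      rw [hr1, ← log_le_iff_le_exp hr.1]; linarith
    have hfr := hfB r hr.1 hrr1
    rw [abs_of_neg (by linarith)] at hfr
    have hlogy0 : 0 ≤ log y := log_nonneg hy1.le
    have hlogy : log y ≤ Z ^ (σ - 1) / (σ - 1) := by
      have h1 : y ≤ Z := by
        refine le_trans ?_ hyK
        simpa using rpow_le_rpow_of_exponent_le hy1.le hp
      exact (log_le_log hy0 h1).trans (log_le_rpow_div (by linarith) hσ1)
    have hfZ : f r * Z ^ σ ≤ B * K ^ σ := by
      rw [hZ, mul_rpow hK.le hL0.le]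
      calc f r * (K ^ σ * (-log r) ^ σ) = f r * (-log r) ^ σ * K ^ σ := by ring
        _ ≤ _ := by gcongr
    have hz : f r * log y * Z ≤ C2 := by
      calc f r * log y * Z ≤ f r * (Z ^ (σ - 1) / (σ - 1)) * Z := by gcongr
        _ = f r * (Z ^ (σ - 1) * Z ^ (1:ℝ)) / (σ - 1) := by rw [rpow_one]; ring
        _ = f r * Z ^ σ / (σ - 1) := by
          rw [← rpow_add (by linarith)]; ring_nf
        _ ≤ C2 := by rw [hC2]; gcongr
    have hz0 : 0 ≤ f r * log y := by positivity
    have hzC : f r * log y ≤ C2 := by nlinarith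
    have hexp : y ^ f r - 1 ≤ f r * log y * exp C2 := by
      rw [rpow_def_of_pos hy0, mul_comm (log y)]
      have h1 : 1 - f r * log y ≤ exp (-(f r * log y)) := by
        linarith [add_one_le_exp (-(f r * log y))]
      have h2 : exp (f r * log y) * exp (-(f r * log y)) = 1 := by
        rw [← exp_add]; simp
      have h3 : exp (f r * log y) ≤ exp C2 := exp_le_exp.2 hzC
      have h4 : 0 < exp (f r * log y) := exp_pos _
      nlinarith
    have hyf : 0 ≤ y ^ f r - 1 := by linarith [one_le_rpow hy1.le hf0]
    have hmain : y ^ p * (y ^ f r - 1) ≤ C2 * exp C2 := by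
      calc y ^ p * (y ^ f r - 1) ≤ Z * (f r * log y * exp C2) := by gcongr
        _ = (f r * log y * Z) * exp C2 := by ring
        _ ≤ _ := by gcongr
    calc β * y ^ (p + f r) ≤ μ * y ^ (p + f r) := by gcongr
      _ = μ * y ^ p + μ * (y ^ p * (y ^ f r - 1)) := by rw [rpow_add hy0]; ring
      _ ≤ μ * y ^ p + (β + μ * (C2 * exp C2)) := by
        have := mul_le_mul_of_nonneg_left hmain hμ.le
        linarith

/-- The weighted radial Hölder inequality. -/
lemma abs_integral_le_weighted {k : ℕ} (hk : 0 < k) {v' : ℝ → ℝ} {a b : ℝ} (ha : 0 < a)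
    (hab : a ≤ b) (hv : IntegrableOn v' (Ioc a b))
    (hw : IntegrableOn (fun r => r ^ k * |v' r| ^ (k + 1)) (Ioc a b)) :
    |∫ t in a..b, v' t| ≤ (∫ r in Ioc a b, r ^ k * |v' r| ^ (k + 1)) ^ (1 / (k + 1 : ℝ)) *
      (log b - log a) ^ (k / (k + 1 : ℝ)) := by
  have hk0 : (0 : ℝ) < k := by exact_mod_cast hk
  have hb : 0 < b := ha.trans_le hab
  have hpos : ∀ r ∈ Ioc a b, 0 < r := fun r hr => ha.trans hr.1
  have hae : ∀ᵐ r ∂(volume.restrict (Ioc a b)), 0 < r :=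
    (ae_restrict_iff' measurableSet_Ioc).2 (Eventually.of_forall hpos)
  set F : ℝ → ℝ := fun r => r ^ (k / (k + 1 : ℝ)) * |v' r| with hF
  set H : ℝ → ℝ := fun r => r ^ (-(k / (k + 1 : ℝ))) with hH
  have hpq : ((k : ℝ) + 1).HolderConjugate ((k + 1 : ℝ) / k) := by
    rw [Real.holderConjugate_iff]
    exact ⟨by linarith, by field_simp; ring⟩
  have hFp : ∀ r, 0 < r → F r ^ ((k : ℝ) + 1) = r ^ k * |v' r| ^ (k + 1) := by
    intro r hr
    rw [hF]
    simp only
    rw [mul_rpow (by positivity) (abs_nonneg _), ← rpow_mul hr.le,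
      div_mul_cancel₀ _ (by positivity), rpow_natCast]
    norm_cast
  have hHq : ∀ r, 0 < r → H r ^ ((k + 1 : ℝ) / k) = r⁻¹ := by
    intro r hr
    rw [hH]
    simp only
    rw [← rpow_mul hr.le, ← rpow_neg_one]
    congr 1
    field_simp
  have hFm : AEStronglyMeasurable F (volume.restrict (Ioc a b)) := by
    refine AEStronglyMeasurable.mul ?_ hv.aestronglyMeasurable.norm
    exact (measurable_id.pow_const _).aestronglyMeasurable
  have hHm : AEStronglyMeasurable H (volume.restrict (Ioc a b)) :=
    (measurable_id.pow_const _).aestronglyMeasurable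
  have hinv : IntegrableOn (fun r : ℝ => r⁻¹) (Ioc a b) := by
    refine (ContinuousOn.integrableOn_Icc ?_).mono_set Ioc_subset_Icc_self
    exact continuousOn_inv₀.mono fun r hr => (ha.trans_le hr.1).ne'
  have hF0 : ∀ r, 0 < r → 0 ≤ F r := fun r hr => by rw [hF]; positivity
  have hH0 : ∀ r, 0 < r → 0 ≤ H r := fun r hr => by rw [hH]; positivity
  have hFL : MemLp F (ENNReal.ofReal ((k : ℝ) + 1)) (volume.restrict (Ioc a b)) := by
    rw [← integrable_norm_rpow_iff hFm (by simp; positivity) (by simp),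
      ENNReal.toReal_ofReal (by positivity)]
    refine hw.congr ?_
    filter_upwards [hae] with r hr
    rw [norm_of_nonneg (hF0 r hr), hFp r hr]
  have hHL : MemLp H (ENNReal.ofReal ((k + 1 : ℝ) / k)) (volume.restrict (Ioc a b)) := by
    rw [← integrable_norm_rpow_iff hHm (by simp; positivity) (by simp),
      ENNReal.toReal_ofReal (by positivity)]
    refine hinv.congr ?_
    filter_upwards [hae] with r hr
    rw [norm_of_nonneg (hH0 r hr), hHq r hr]
  have h := integral_mul_le_Lp_mul_Lq_of_nonneg hpq (μ := volume.restrict (Ioc a b))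
    (hae.mono hF0) (hae.mono hH0) hFL hHL
  have e1 : ∫ r in Ioc a b, F r * H r = ∫ r in Ioc a b, |v' r| := by
    refine integral_congr_ae ?_
    filter_upwards [hae] with r hr
    rw [hF, hH]
    simp only
    rw [rpow_neg hr.le]
    have : 0 < r ^ (k / (k + 1 : ℝ)) := by positivity
    field_simp
  have e2 : ∫ r in Ioc a b, F r ^ ((k : ℝ) + 1) = ∫ r in Ioc a b, r ^ k * |v' r| ^ (k + 1) :=
    integral_congr_ae (hae.mono hFp)
  have e3 : ∫ r in Ioc a b, H r ^ ((k + 1 : ℝ) / k) = log b - log a := by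
    rw [integral_congr_ae (hae.mono hHq), ← intervalIntegral.integral_of_le hab,
      integral_inv_of_pos ha hb, log_div hb.ne' ha.ne']
  rw [e1, e2, e3, one_div_div] at h
  refine le_trans ?_ h
  rw [intervalIntegral.integral_of_le hab]
  exact abs_integral_le_integral_abs

lemma lintegral_Icc_inv {a b : ℝ} (ha : 0 < a) (hab : a ≤ b) :
    ∫⁻ r in Icc a b, ENNReal.ofReal r⁻¹ = ENNReal.ofReal (log b - log a) := by
  have hinv : IntegrableOn (fun r : ℝ => r⁻¹) (Icc a b) :=
    ContinuousOn.integrableOn_Icc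
      (continuousOn_inv₀.mono fun r hr => (ha.trans_le hr.1).ne')
  have hb := ha.trans_le hab
  rw [← ofReal_integral_eq_lintegral_ofReal hinv, integral_Icc_eq_integral_Ioc,
    ← intervalIntegral.integral_of_le hab, integral_inv_of_pos ha hb, log_div hb.ne' ha.ne']
  refine (ae_restrict_iff' measurableSet_Icc).2 (Eventually.of_forall fun r hr => ?_)
  exact inv_nonneg.2 (ha.le.trans hr.1)

/-- Moser's inequality in the logarithmic variable, with a constant depending only on `k`. -/
lemma moser_lintegral_le {k : ℕ} (hk : 0 < k) {V G : ℝ → ℝ}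
    (hV : ∀ r ∈ Ioo (0:ℝ) 1, 0 ≤ V r) (hG0 : ∀ r ∈ Ioo (0:ℝ) 1, 0 ≤ G r)
    (hG1 : ∀ r ∈ Ioo (0:ℝ) 1, G r ≤ 1)
    (hGanti : ∀ a ∈ Ioo (0:ℝ) 1, ∀ b ∈ Ioo (0:ℝ) 1, a ≤ b → G b ≤ G a)
    (hVG : ∀ r ∈ Ioo (0:ℝ) 1, V r ≤ G r ^ (1 / (k + 1 : ℝ)) * (-log r) ^ (k / (k + 1 : ℝ)))
    (hVV : ∀ a ∈ Ioo (0:ℝ) 1, ∀ b ∈ Ioo (0:ℝ) 1, a ≤ b →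
      V a ≤ V b + (G a - G b) ^ (1 / (k + 1 : ℝ)) * (log b - log a) ^ (k / (k + 1 : ℝ)))
    (hVL : ∀ r ∈ Ioo (0:ℝ) 1, V r ^ ((k + 1 : ℝ) / k) ≤ -log r) :
    ∫⁻ r in Ioo (0:ℝ) 1, ENNReal.ofReal (r⁻¹ * exp (-(-log r - V r ^ ((k + 1 : ℝ) / k)))) ≤
      ∑' n : ℕ, ENNReal.ofReal
        ((5 * (1 + 2 ^ (k + 1) * k) * (n + 1)) * exp (-n)) := by
  set M : ℝ := 2 ^ (k + 1) * k with hM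
  have hM0 : 0 ≤ M := by positivity
  set D : ℝ → ℝ := fun r => -log r - V r ^ ((k + 1 : ℝ) / k) with hD
  have hcover : ∀ n : ℕ, ∃ S : Set ℝ, MeasurableSet S ∧
      (∀ r ∈ Ioo (0:ℝ) 1, D r ≤ n + 1 → r ∈ S) ∧
      ∫⁻ r in S, ENNReal.ofReal r⁻¹ ≤ ENNReal.ofReal (5 * (1 + M) * (n + 1)) := by
    intro n
    set l : ℝ := n + 1 with hl
    have hl0 : 0 < l := by positivity
    have hlog : ∀ x y : ℝ, log (exp y) - log (exp x) = y - x := by simp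
    have hnear : ∫⁻ r in Icc (exp (-(M * l))) (exp 0), ENNReal.ofReal r⁻¹
        = ENNReal.ofReal (M * l) := by
      rw [lintegral_Icc_inv (exp_pos _) (exp_le_exp.2 (by linarith [mul_nonneg hM0 hl0.le])),
        hlog]
      congr 1; ring
    by_cases hex : ∃ r0 ∈ Ioo (0:ℝ) 1, D r0 ≤ l ∧ M * l ≤ -log r0
    · obtain ⟨r0, hr0, hr0D, hr0M⟩ := hex
      set c : ℝ := 2 * (1 + M) * l with hc
      have hc0 : 0 ≤ c := by positivity
      have hgap : ∀ a ∈ Ioo (0:ℝ) 1, ∀ b ∈ Ioo (0:ℝ) 1, a ≤ b → D a ≤ l → D b ≤ l →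
          M * l ≤ -log b → log b - log a ≤ c := by
        intro a ha b hb hab hDa hDb hMb
        have hlogab := log_le_log ha.1 hab
        refine moser_gap hk (x := -log b) (A := V b) (B := V a) (g := G b) (d := G a - G b)
          hl0 (by linarith) hMb (hV b hb) (hV a ha) (hG0 b hb)
          (by linarith [hGanti a ha b hb hab]) (by linarith [hG1 a ha]) (hVG b hb)
          (hVV a ha b hb hab) ?_ ?_
        · simp only [hD] at hDb; linarith
        · simp only [hD] at hDa; linarith
      refine ⟨Icc (exp (-(M * l))) (exp 0) ∪ Icc (exp (log r0 - c)) (exp (log r0 + c)),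
        measurableSet_Icc.union measurableSet_Icc, fun r hr hrD => ?_, ?_⟩
      · rcases le_total (-log r) (M * l) with h | h
        · left
          refine ⟨?_, by rw [exp_zero]; exact hr.2.le⟩
          rw [← le_log_iff_exp_le hr.1]; linarith
        · right
          have : log r0 - c ≤ log r ∧ log r ≤ log r0 + c := by
            rcases le_total r r0 with h' | h'
            · have := hgap r hr r0 hr0 h' hrD hr0D hr0M
              exact ⟨by linarith, by linarith [log_le_log hr.1 h']⟩
            · have := hgap r0 hr0 r hr h' hr0D hrD h
              exact ⟨by linarith [log_le_log hr0.1 h'], by linarith⟩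
          exact ⟨(le_log_iff_exp_le hr.1).1 this.1, (log_le_iff_le_exp hr.1).1 this.2⟩
      · refine (lintegral_union_le _ _ _).trans ?_
        rw [hnear, lintegral_Icc_inv (exp_pos _) (exp_le_exp.2 (by linarith)), hlog,
          ← ENNReal.ofReal_add (by positivity) (by linarith)]
        apply ENNReal.ofReal_le_ofReal
        rw [hc]
        nlinarith
    · push Not at hex
      refine ⟨Icc (exp (-(M * l))) (exp 0), measurableSet_Icc, fun r hr hrD => ?_, ?_⟩
      · have h := hex r hr hrD
        refine ⟨?_, by rw [exp_zero]; exact hr.2.le⟩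
        rw [← le_log_iff_exp_le hr.1]; linarith
      · rw [hnear]
        apply ENNReal.ofReal_le_ofReal
        nlinarith [mul_nonneg hM0 hl0.le]
  choose S hSm hSD hSi using hcover
  have hinvm : Measurable fun r : ℝ => ENNReal.ofReal r⁻¹ := by fun_prop
  calc ∫⁻ r in Ioo (0:ℝ) 1, ENNReal.ofReal (r⁻¹ * exp (-D r))
      ≤ ∫⁻ r in Ioo (0:ℝ) 1, ∑' n : ℕ, (S n).indicator
          (fun r => ENNReal.ofReal r⁻¹ * ENNReal.ofReal (exp (-n))) r := by
        refine setLIntegral_mono' measurableSet_Ioo fun r hr => ?_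
        have hD0 : 0 ≤ D r := by simp only [hD]; linarith [hVL r hr]
        refine le_trans ?_ (ENNReal.le_tsum ⌊D r⌋₊)
        rw [indicator_of_mem (hSD _ r hr (Nat.lt_floor_add_one _).le),
          ← ENNReal.ofReal_mul (inv_nonneg.2 hr.1.le)]
        apply ENNReal.ofReal_le_ofReal
        have := Nat.floor_le hD0
        have h0 := inv_nonneg.2 hr.1.le
        gcongr
    _ = ∑' n : ℕ, ∫⁻ r in Ioo (0:ℝ) 1, (S n).indicator
          (fun r => ENNReal.ofReal r⁻¹ * ENNReal.ofReal (exp (-n))) r :=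
        lintegral_tsum fun n => ((hinvm.mul_const _).indicator (hSm n)).aemeasurable
    _ ≤ _ := by
        refine ENNReal.tsum_le_tsum fun n => ?_
        refine (setLIntegral_le_lintegral _ _).trans ?_
        rw [lintegral_indicator (hSm n), lintegral_mul_const _ hinvm,
          ENNReal.ofReal_mul (by positivity)]
        gcongr
        exact hSi n

lemma omegaS_pos {N : ℕ} (hN : 0 < N) : 0 < omegaS N := by
  have : 0 < (volume (Metric.ball (0 : EuclideanSpace ℝ (Fin N)) 1)).toReal :=
    ENNReal.toReal_pos (Metric.measure_ball_pos _ _ one_pos).ne' measure_ball_lt_top.ne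
  rw [omegaS]
  positivity

lemma cN_pos {k : ℕ} (hk : 0 < k) : 0 < cN (2 * k) k := by
  have h1 := omegaS_pos (N := 2 * k) (by omega)
  have h2 : 0 < (2 * k).choose k := Nat.choose_pos (by omega)
  rw [cN]
  positivity

lemma muN_eq {k : ℕ} (hk : 0 < k) :
    muN (2 * k) k = (2 * k : ℕ) * cN (2 * k) k ^ (1 / (k : ℝ)) := by
  have hk0 : (0 : ℝ) < k := by exact_mod_cast hk
  have h : (2 * k) * (2 * k - 1).choose (k - 1) = (2 * k).choose k * k := by
    have := Nat.add_one_mul_choose_eq (2 * k - 1) (k - 1)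
    rwa [Nat.sub_add_cancel (by omega), Nat.sub_add_cancel (by omega)] at this
  have h' : (2 * k : ℝ) * ((2 * k - 1).choose (k - 1) : ℕ) = ((2 * k).choose k : ℕ) * k := by
    exact_mod_cast h
  rw [muN, cN]
  congr 2
  · push_cast
    rw [div_eq_div_iff (by positivity) (by positivity)]
    linear_combination omegaS (2 * k) * h'
  · push_cast
    field_simp

/-- The Hölder bounds for a function of unit norm in `X₁`, normalised so that the total weighted
gradient mass is one. -/
lemma MemX1.normalised_bounds {k : ℕ} (hk : 0 < k) {v v' : ℝ → ℝ} (hv : MemX1 (2 * k) k v v')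
    (hnorm : normX1 (2 * k) k v' = 1) :
    ∃ G : ℝ → ℝ, (∀ r ∈ Ioo (0:ℝ) 1, 0 ≤ G r) ∧ (∀ r ∈ Ioo (0:ℝ) 1, G r ≤ 1) ∧
      (∀ a ∈ Ioo (0:ℝ) 1, ∀ b ∈ Ioo (0:ℝ) 1, a ≤ b → G b ≤ G a) ∧
      (∀ r ∈ Ioo (0:ℝ) 1, cN (2 * k) k ^ (1 / (k + 1 : ℝ)) * |v r| ≤
        G r ^ (1 / (k + 1 : ℝ)) * (-log r) ^ (k / (k + 1 : ℝ))) ∧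
      (∀ a ∈ Ioo (0:ℝ) 1, ∀ b ∈ Ioo (0:ℝ) 1, a ≤ b →
        cN (2 * k) k ^ (1 / (k + 1 : ℝ)) * |v a| ≤ cN (2 * k) k ^ (1 / (k + 1 : ℝ)) * |v b| +
          (G a - G b) ^ (1 / (k + 1 : ℝ)) * (log b - log a) ^ (k / (k + 1 : ℝ))) := by
  have hc := cN_pos hk
  have hk0 : (0 : ℝ) < k := by exact_mod_cast hk
  set c := cN (2 * k) k with hcdef
  have hNk : 2 * k - k = k := by omega
  set w : ℝ → ℝ := fun r => r ^ k * |v' r| ^ (k + 1) with hw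
  have hint : IntegrableOn w (Ioo 0 1) := by
    by_contra hnot
    have h0 : ∫ r in Ioo (0:ℝ) 1, w r = 0 := integral_undef hnot
    rw [normX1, hNk, ← hcdef] at hnorm
    simp only [hw] at h0
    rw [h0, mul_zero, zero_rpow (by positivity)] at hnorm
    exact zero_ne_one hnorm
  have htot : c * ∫ r in Ioo (0:ℝ) 1, w r = 1 := by
    rw [normX1, hNk, ← hcdef] at hnorm
    have hnn : 0 ≤ c * ∫ r in Ioo (0:ℝ) 1, w r := by
      refine mul_nonneg hc.le (setIntegral_nonneg measurableSet_Ioo fun r hr => ?_)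
      have := hr.1
      simp only [hw]; positivity
    rw [one_div] at hnorm
    have h := (rpow_inv_eq hnn zero_le_one (by positivity : (k : ℝ) + 1 ≠ 0)).1 hnorm
    rwa [one_rpow] at h
  have hw0 : ∀ r ∈ Ioo (0:ℝ) 1, 0 ≤ w r := by
    intro r hr
    have := hr.1
    simp only [hw]; positivity
  set G : ℝ → ℝ := fun r => c * ∫ t in Ioo r 1, w t with hG
  have hsub : ∀ r ∈ Ioo (0:ℝ) 1, Ioo r 1 ⊆ Ioo 0 1 := fun r hr => Ioo_subset_Ioo_left hr.1.le
  have hG0 : ∀ r ∈ Ioo (0:ℝ) 1, 0 ≤ G r := fun r hr =>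
    mul_nonneg hc.le (setIntegral_nonneg measurableSet_Ioo fun t ht => hw0 t (hsub r hr ht))
  have hG1 : ∀ r ∈ Ioo (0:ℝ) 1, G r ≤ 1 := by
    intro r hr
    rw [← htot]
    refine mul_le_mul_of_nonneg_left ?_ hc.le
    refine setIntegral_mono_set hint ?_ (hsub r hr).eventuallyLE
    exact (ae_restrict_iff' measurableSet_Ioo).2 (Eventually.of_forall hw0)
  have hIoc : ∀ a ∈ Ioo (0:ℝ) 1, ∀ b ∈ Ioo (0:ℝ) 1, Ioc a b ⊆ Ioo 0 1 := fun a ha b hb t ht =>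
    ⟨ha.1.trans ht.1, ht.2.trans_lt hb.2⟩
  have hGsub : ∀ a ∈ Ioo (0:ℝ) 1, ∀ b ∈ Ioo (0:ℝ) 1, a ≤ b →
      G a - G b = c * ∫ t in Ioc a b, w t := by
    intro a ha b hb hab
    have hu : Ioc a b ∪ Ioo b 1 = Ioo a 1 := Ioc_union_Ioo_eq_Ioo hab hb.2
    have hd : Disjoint (Ioc a b) (Ioo b 1) :=
      disjoint_left.2 fun t h1 h2 => absurd h1.2 (not_le.2 h2.1)
    have := setIntegral_union hd measurableSet_Ioo (hint.mono_set (hIoc a ha b hb))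
      (hint.mono_set (hsub b hb))
    simp only [hG]
    rw [← hu, this]
    ring
  have hGanti : ∀ a ∈ Ioo (0:ℝ) 1, ∀ b ∈ Ioo (0:ℝ) 1, a ≤ b → G b ≤ G a := by
    intro a ha b hb hab
    have h1 : 0 ≤ c * ∫ t in Ioc a b, w t := mul_nonneg hc.le
      (setIntegral_nonneg measurableSet_Ioc fun t ht => hw0 t (hIoc a ha b hb ht))
    linarith [hGsub a ha b hb hab]
  have hVV : ∀ a ∈ Ioo (0:ℝ) 1, ∀ b ∈ Ioo (0:ℝ) 1, a ≤ b →
      c ^ (1 / (k + 1 : ℝ)) * |v a| ≤ c ^ (1 / (k + 1 : ℝ)) * |v b| +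
        (G a - G b) ^ (1 / (k + 1 : ℝ)) * (log b - log a) ^ (k / (k + 1 : ℝ)) := by
    intro a ha b hb hab
    obtain ⟨hi, he⟩ := hv.locAC a ha b hb
    have h := abs_integral_le_weighted hk ha.1 hab
      ((intervalIntegrable_iff_integrableOn_Ioc_of_le hab).1 hi)
      (hint.mono_set (hIoc a ha b hb))
    rw [← he] at h
    have h1 : |v a| ≤ |v b| + |v b - v a| := by
      have := abs_sub_abs_le_abs_sub (v a) (v b)
      rw [abs_sub_comm] at this
      linarith
    rw [hGsub a ha b hb hab, mul_rpow hc.le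
      (setIntegral_nonneg measurableSet_Ioc fun t ht => hw0 t (hIoc a ha b hb ht)),
      mul_assoc, ← mul_add]
    exact mul_le_mul_of_nonneg_left (h1.trans (by linarith)) (by positivity)
  refine ⟨G, hG0, hG1, hGanti, fun r hr => ?_, hVV⟩
  have hlim : Tendsto (fun b => c ^ (1 / (k + 1 : ℝ)) * |v b| +
      G r ^ (1 / (k + 1 : ℝ)) * (-log r) ^ (k / (k + 1 : ℝ))) (nhdsWithin 1 (Iio 1))
      (nhds (c ^ (1 / (k + 1 : ℝ)) * |0| +
        G r ^ (1 / (k + 1 : ℝ)) * (-log r) ^ (k / (k + 1 : ℝ)))) :=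
    (hv.lim_one.abs.const_mul _).add_const _
  rw [abs_zero, mul_zero, zero_add] at hlim
  refine ge_of_tendsto hlim ?_
  filter_upwards [Ioo_mem_nhdsLT hr.2] with b hb
  have hb' : b ∈ Ioo (0:ℝ) 1 := ⟨hr.1.trans hb.1, hb.2⟩
  refine (hVV r hr b hb' hb.1.le).trans ?_
  have h1 := hGanti r hr b hb' hb.1.le
  have h2 := log_le_log hr.1 hb.1.le
  have h3 := hG0 b hb'
  have h4 := log_nonpos hb'.1.le hb'.2.le
  have h5 := hG0 r hr
  gcongr <;> linarith

theorem stmt5 (N k : ℕ) (hk : 0 < k) (hN : N = 2 * k)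
    (f : ℝ → ℝ) (hfc : ContinuousOn f (Ico 0 1)) (hf0 : f 0 = 0)
    (hfpos : ∀ r ∈ Ioo (0:ℝ) 1, 0 < f r) (hfnn : ∀ r ∈ Ico (0:ℝ) 1, 0 ≤ f r)
    (hσ : ∃ σ : ℝ, 1 < σ ∧ IsBoundedUnder (· ≤ ·) (nhdsWithin (0:ℝ) (Ioi 0))
      (fun r => f r * |log r| ^ σ))
    (β : ℝ) (hβ : 0 < β) (hβ' : β ≤ muN N k) :
    (⨆ p : {p : (ℝ → ℝ) × (ℝ → ℝ) // MemX1 N k p.1 p.2 ∧ normX1 N k p.2 = 1},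
      mtIntegral N β f p.1.1) < ⊤ := by
  subst hN
  obtain ⟨σ, hσ1, hfσ⟩ := hσ
  have hk0 : (0 : ℝ) < k := by exact_mod_cast hk
  have hc := cN_pos hk
  set c := cN (2 * k) k with hcdef
  set p : ℝ := (k + 1 : ℝ) / k with hp
  have hp1 : 1 ≤ p := by rw [hp, le_div_iff₀ hk0]; linarith
  have hp0 : 0 < p := by linarith
  have hpN : (((2 * k : ℕ) : ℝ) + 2) / (2 * k : ℕ) = p := by
    rw [hp]; push_cast; field_simp
  have hck : 0 < c ^ (1 / (k : ℝ)) := by positivity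
  obtain ⟨C, hC⟩ := exists_supercritical_bound hfc hfnn hσ1 hfσ hβ hβ' hp1 (inv_pos.2 hck)
  set T : ℝ≥0∞ := ∑' n : ℕ, ENNReal.ofReal
    ((5 * (1 + 2 ^ (k + 1) * k) * (n + 1)) * exp (-n)) with hT
  have hTtop : T < ⊤ := by
    have h1 : Summable fun n : ℕ => (n : ℝ) ^ 1 * exp (-n) := by
      simpa using summable_pow_mul_exp_neg_nat_mul 1 one_pos
    have h0 : Summable fun n : ℕ => (n : ℝ) ^ 0 * exp (-n) := by
      simpa using summable_pow_mul_exp_neg_nat_mul 0 one_pos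
    refine lt_top_iff_ne_top.2 (Summable.tsum_ofReal_ne_top ?_)
    refine ((h1.add h0).mul_left (5 * (1 + 2 ^ (k + 1) * (k : ℝ)))).congr fun n => ?_
    ring
  refine lt_of_le_of_lt (iSup_le ?_) (ENNReal.mul_lt_top (ENNReal.ofReal_lt_top (r := exp C)) hTtop)
  rintro ⟨⟨v, v'⟩, hv, hnorm⟩
  obtain ⟨G, hG0, hG1, hGanti, hVG, hVV⟩ := hv.normalised_bounds hk hnorm
  rw [← hcdef] at hVG hVV
  set V : ℝ → ℝ := fun r => c ^ (1 / (k + 1 : ℝ)) * |v r| with hV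
  have hV0 : ∀ r, 0 ≤ V r := fun r => by simp only [hV]; positivity
  have hVp : ∀ r, V r ^ p = c ^ (1 / (k : ℝ)) * |v r| ^ p := by
    intro r
    simp only [hV]
    rw [mul_rpow (by positivity) (abs_nonneg _), ← rpow_mul hc.le]
    congr 2
    rw [hp]; field_simp
  have hlog : ∀ r ∈ Ioo (0:ℝ) 1, 0 ≤ -log r := fun r hr => by
    linarith [log_nonpos hr.1.le hr.2.le]
  have hVL : ∀ r ∈ Ioo (0:ℝ) 1, V r ^ p ≤ -log r := by
    intro r hr
    have h1 : V r ≤ (-log r) ^ (k / (k + 1 : ℝ)) := by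
      refine (hVG r hr).trans (mul_le_of_le_one_left (rpow_nonneg (hlog r hr) _) ?_)
      exact rpow_le_one (hG0 r hr) (hG1 r hr) (by positivity)
    refine (rpow_le_rpow (hV0 r) h1 hp0.le).trans_eq ?_
    have h2 : (k : ℝ) / (k + 1) * p = 1 := by rw [hp]; field_simp
    rw [← rpow_mul (hlog r hr), h2, rpow_one]
  have hmoser := moser_lintegral_le hk (fun r _ => hV0 r) hG0 hG1 hGanti hVG hVV hVL
  refine le_trans ?_ (mul_le_mul_right hmoser _)
  rw [mtIntegral, ← lintegral_const_mul' _ _ ENNReal.ofReal_ne_top]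
  refine setLIntegral_mono' measurableSet_Ioo fun r hr => ?_
  rw [← ENNReal.ofReal_mul (exp_pos _).le]
  apply ENNReal.ofReal_le_ofReal
  have hr0 := hr.1
  have hbound := hC r hr |v r| (abs_nonneg _) (by
    rw [← div_eq_inv_mul, le_div_iff₀ hck, mul_comm, ← hVp]
    exact hVL r hr)
  rw [muN_eq hk, ← hcdef, mul_assoc, ← hVp] at hbound
  rw [hpN]
  have hpow : r ^ (2 * k - 1) = r⁻¹ * exp (-((2 * k : ℕ) * -log r)) := by
    have h1 : exp (-((2 * k : ℕ) * -log r)) = r ^ (2 * k) := by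
      rw [mul_neg, neg_neg, exp_nat_mul, exp_log hr0]
    rw [h1, ← Nat.sub_add_cancel (show 1 ≤ 2 * k by omega), pow_succ, Nat.add_sub_cancel]
    field_simp
  have h2k : (1 : ℝ) ≤ (2 * k : ℕ) := by exact_mod_cast (by omega : 1 ≤ 2 * k)
  rw [hpow, mul_assoc, ← exp_add, mul_left_comm, ← exp_add]
  refine mul_le_mul_of_nonneg_left (exp_le_exp.2 ?_) (inv_nonneg.2 hr0.le)
  have hgap := sub_nonneg.2 (hVL r hr)
  have hmul := mul_le_mul_of_nonneg_right h2k hgap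
  linarith
end

section
/- Let N ≥ 2 be an even integer, k = N/2, and let f : [0,1) → [0,∞) be continuous with f(0) = 0 and f(r) > 0 for r ∈ (0,1), satisfying limsup_{r→0⁺} f(r)·|ln r|^σ < ∞ for some σ > 1. Then there exist constants C > 0 and ρ̂ ∈ (0,1), independent of v, such that for every v ∈ X_1 with ‖v‖_{X_1} = 1 and every r ∈ (0, ρ̂], exp( μ_N |v(r)|^{(N+2)/N} · ( |v(r)|^{f(r)} − 1 ) ) ≤ C. -/
open MeasureTheory Real Set Filter
open scoped ENNReal

/-- Splitting at the threshold `s`: either `y ≤ s`, or `y ^ (k + 1)` dominates `s ^ k * y`. -/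
lemma le_add_pow_succ_div_pow {y s : ℝ} (hy : 0 ≤ y) (hs : 0 < s) (k : ℕ) :
    y ≤ s + y ^ (k + 1) / s ^ k := by
  rcases le_total y s with h | h
  · have : 0 ≤ y ^ (k + 1) / s ^ k := by positivity
    linarith
  · have h1 : s ^ k ≤ y ^ k := pow_le_pow_left₀ hs.le h k
    have h2 : y ≤ y ^ (k + 1) / s ^ k := by
      rw [le_div_iff₀ (by positivity), pow_succ']
      exact mul_le_mul_of_nonneg_left h1 hy
    linarith

/-- A function of unit norm has an integrable weighted gradient, whose integral is `(cN N k)⁻¹`. -/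
lemma integral_of_normX1_eq_one {N k : ℕ} {v' : ℝ → ℝ} (h : normX1 N k v' = 1) :
    IntegrableOn (fun r => r ^ (N - k) * |v' r| ^ (k + 1)) (Ioo (0:ℝ) 1) ∧
      ∫ r in Ioo (0:ℝ) 1, r ^ (N - k) * |v' r| ^ (k + 1) = (cN N k)⁻¹ := by
  unfold normX1 at h
  have hI : 0 ≤ ∫ r in Ioo (0:ℝ) 1, r ^ (N - k) * |v' r| ^ (k + 1) := by
    refine setIntegral_nonneg measurableSet_Ioo fun r hr => ?_
    have := hr.1
    positivity
  have hc : 0 ≤ cN N k := by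
    unfold cN omegaS
    positivity
  have hk : (1 / (k + 1 : ℝ)) ≠ 0 := by positivity
  have h1 : cN N k * ∫ r in Ioo (0:ℝ) 1, r ^ (N - k) * |v' r| ^ (k + 1) = 1 :=
    (Real.rpow_left_inj (mul_nonneg hc hI) zero_le_one hk).1 (by rw [h, Real.one_rpow])
  refine ⟨?_, (inv_eq_of_mul_eq_one_right h1).symm⟩
  by_contra hn
  rw [integral_undef hn, mul_zero] at h1
  exact zero_ne_one h1

/-- The radial estimate with a free parameter `s`. -/
lemma MemX1.abs_le_of_pos {k : ℕ} {v v' : ℝ → ℝ} (hv : MemX1 (2 * k) k v v')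
    (hnorm : normX1 (2 * k) k v' = 1) {r s : ℝ} (hr : r ∈ Ioo (0:ℝ) 1) (hs : 0 < s) :
    |v r| ≤ s * |log r| + (cN (2 * k) k)⁻¹ / s ^ k := by
  obtain ⟨hint, hval⟩ := integral_of_normX1_eq_one hnorm
  have hkk : 2 * k - k = k := by omega
  rw [hkk] at hint hval
  have hlog : ∀ b ∈ Ioo r 1, log (b / r) ≤ |log r| := by
    intro b hb
    rw [Real.log_div (by linarith [hb.1, hr.1]) hr.1.ne', abs_of_neg (Real.log_neg hr.1 hr.2)]
    linarith [Real.log_neg (hr.1.trans hb.1) hb.2]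
  have key : ∀ b ∈ Ioo r 1, |v r| ≤ |v b| + (s * |log r| + (cN (2 * k) k)⁻¹ / s ^ k) := by
    intro b hb
    have hb0 : 0 < b := hr.1.trans hb.1
    obtain ⟨hii, heq⟩ := hv.locAC r hr b ⟨hb0, hb.2⟩
    have hsub : Ioc r b ⊆ Ioo (0:ℝ) 1 := fun t ht => ⟨hr.1.trans ht.1, ht.2.trans_lt hb.2⟩
    have hgi : IntervalIntegrable (fun t => t ^ k * |v' t| ^ (k + 1)) volume r b :=
      (intervalIntegrable_iff_integrableOn_Ioc_of_le hb.1.le).2 (hint.mono_set hsub)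
    have hinv : IntervalIntegrable (fun t : ℝ => t⁻¹) volume r b := by
      refine intervalIntegral.intervalIntegrable_inv (fun t ht => ?_) continuousOn_id
      rw [uIcc_of_le hb.1.le] at ht
      exact (hr.1.trans_le ht.1).ne'
    have h1 : |v b - v r| ≤ ∫ t in r..b, |v' t| := by
      rw [heq]
      exact intervalIntegral.abs_integral_le_integral_abs hb.1.le
    have h2 : ∫ t in r..b, |v' t| ≤
        ∫ t in r..b, (s * t⁻¹ + (t ^ k * |v' t| ^ (k + 1)) / s ^ k) := by
      refine intervalIntegral.integral_mono_on hb.1.le hii.abs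
        ((hinv.const_mul s).add (hgi.div_const _)) fun t ht => ?_
      have ht0 : 0 < t := hr.1.trans_le ht.1
      have h := le_add_pow_succ_div_pow (y := t * |v' t|) (by positivity) hs k
      have h' := mul_le_mul_of_nonneg_left h (inv_nonneg.2 ht0.le)
      calc |v' t| = t⁻¹ * (t * |v' t|) := by field_simp
        _ ≤ _ := h'
        _ = _ := by
          rw [mul_pow, pow_succ t]
          field_simp
    rw [intervalIntegral.integral_add (hinv.const_mul s) (hgi.div_const _),
      intervalIntegral.integral_const_mul, intervalIntegral.integral_div,
      integral_inv_of_pos hr.1 hb0] at h2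
    have h3 : ∫ t in r..b, t ^ k * |v' t| ^ (k + 1) ≤ (cN (2 * k) k)⁻¹ := by
      rw [← hval, intervalIntegral.integral_of_le hb.1.le]
      refine setIntegral_mono_set hint ?_ hsub.eventuallyLE
      filter_upwards [ae_restrict_mem measurableSet_Ioo] with t ht
      have := ht.1
      simp only [Pi.zero_apply]
      positivity
    have h4 := div_le_div_of_nonneg_right h3 (pow_pos hs k).le
    have h5 := mul_le_mul_of_nonneg_left (hlog b hb) hs.le
    have h6 : |v r| ≤ |v b| + |v b - v r| := by
      have := abs_sub_abs_le_abs_sub (v r) (v b)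
      rw [abs_sub_comm] at this
      linarith
    linarith
  have hlim : Tendsto (fun b => |v b| + (s * |log r| + (cN (2 * k) k)⁻¹ / s ^ k))
      (nhdsWithin 1 (Iio 1)) (nhds (|(0:ℝ)| + (s * |log r| + (cN (2 * k) k)⁻¹ / s ^ k))) :=
    hv.lim_one.abs.add_const _
  rw [abs_zero, zero_add] at hlim
  refine ge_of_tendsto hlim ?_
  filter_upwards [Ioo_mem_nhdsLT hr.2] with b hb using key b hb

/-- The radial estimate `|v(r)| ≤ C |ln r|^{k/(k+1)}` on the unit sphere of `X₁`. -/
lemma MemX1.abs_le_rpow {k : ℕ} {v v' : ℝ → ℝ} (hv : MemX1 (2 * k) k v v')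
    (hnorm : normX1 (2 * k) k v' = 1) {r : ℝ} (hr : r ∈ Ioo (0:ℝ) 1) :
    |v r| ≤ (1 + (cN (2 * k) k)⁻¹) * |log r| ^ ((k : ℝ) / (k + 1)) := by
  have hL : 0 < |log r| := abs_pos.2 (Real.log_neg hr.1 hr.2).ne
  have hk1 : (k : ℝ) + 1 ≠ 0 := by positivity
  have h := hv.abs_le_of_pos hnorm hr (Real.rpow_pos_of_pos hL (-(1 / ((k : ℝ) + 1))))
  have e1 : |log r| ^ (-(1 / ((k : ℝ) + 1))) * |log r| = |log r| ^ ((k : ℝ) / (k + 1)) := by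
    rw [← Real.rpow_add_one hL.ne']
    congr 1
    field_simp
    ring
  have e2 : ((|log r| ^ (-(1 / ((k : ℝ) + 1)))) ^ k)⁻¹ = |log r| ^ ((k : ℝ) / (k + 1)) := by
    rw [← Real.rpow_natCast, ← Real.rpow_mul hL.le, ← Real.rpow_neg hL.le]
    congr 1
    field_simp
  rw [e1, div_eq_mul_inv (cN (2 * k) k)⁻¹, e2] at h
  linarith

/-- A perturbation `a` of the exponent of size `L ^ (-σ)` with `σ > 1` changes `w ^ p`, where
`w ^ p = O(L)` and `w = O(L)`, by a bounded amount. -/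
lemma rpow_mul_rpow_sub_one_le {σ M D L a w p : ℝ} (hσ : 1 < σ) (hM : 0 ≤ M) (hD : 1 ≤ D)
    (hL : 1 ≤ L) (ha : 0 ≤ a) (haL : a * L ^ σ ≤ M) (hw : 0 ≤ w) (hwL : w ≤ D * L)
    (hwp : w ^ p ≤ D ^ p * L) :
    w ^ p * (w ^ a - 1) ≤
      D ^ p * (M * D ^ (σ - 1) / (σ - 1)) * exp (M * D ^ (σ - 1) / (σ - 1)) := by
  have hε : 0 < σ - 1 := by linarith
  have hL0 : 0 < L := by linarith
  have hD0 : 0 < D := by linarith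
  set Q := M * D ^ (σ - 1) / (σ - 1) with hQ
  have hQ0 : 0 ≤ Q := by positivity
  have hwp0 : 0 ≤ w ^ p := Real.rpow_nonneg hw p
  rcases le_total w 1 with h1 | h1
  · have h2 : w ^ a ≤ 1 := Real.rpow_le_one hw h1 ha
    calc w ^ p * (w ^ a - 1) ≤ 0 := mul_nonpos_of_nonneg_of_nonpos hwp0 (by linarith)
      _ ≤ _ := by positivity
  · have hw0 : 0 < w := by linarith
    have hlog : log w ≤ D ^ (σ - 1) * L ^ (σ - 1) / (σ - 1) := by
      rw [← Real.mul_rpow hD0.le hL0.le]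
      exact (Real.log_le_log hw0 hwL).trans (Real.log_le_rpow_div (by positivity) hε)
    have hx : L * (log w * a) ≤ Q := by
      calc L * (log w * a) ≤ L * (D ^ (σ - 1) * L ^ (σ - 1) / (σ - 1) * a) := by gcongr
        _ = (a * (L ^ (σ - 1) * L)) * (D ^ (σ - 1) / (σ - 1)) := by ring
        _ = (a * L ^ σ) * (D ^ (σ - 1) / (σ - 1)) := by
          rw [← Real.rpow_add_one hL0.ne', sub_add_cancel]
        _ ≤ M * (D ^ (σ - 1) / (σ - 1)) := by gcongr
        _ = Q := by rw [hQ]; ring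
    have hx0 : 0 ≤ log w * a := mul_nonneg (Real.log_nonneg h1) ha
    have hxQ : log w * a ≤ Q := by nlinarith
    have hexp : w ^ a - 1 ≤ log w * a * exp (log w * a) := by
      rw [Real.rpow_def_of_pos hw0]
      have h := Real.one_sub_le_exp_neg (log w * a)
      have h' := mul_le_mul_of_nonneg_right h (Real.exp_pos (log w * a)).le
      rw [← Real.exp_add, neg_add_cancel, Real.exp_zero] at h'
      linarith
    calc w ^ p * (w ^ a - 1) ≤ w ^ p * (log w * a * exp (log w * a)) := by gcongr
      _ ≤ (D ^ p * L) * (log w * a * exp Q) := by gcongr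
      _ = D ^ p * (L * (log w * a)) * exp Q := by ring
      _ ≤ D ^ p * Q * exp Q := by gcongr

theorem stmt8 (N k : ℕ) (hk : 0 < k) (hN : N = 2 * k)
    (f : ℝ → ℝ) (hfc : ContinuousOn f (Ico 0 1)) (hf0 : f 0 = 0)
    (hfpos : ∀ r ∈ Ioo (0:ℝ) 1, 0 < f r) (hfnn : ∀ r ∈ Ico (0:ℝ) 1, 0 ≤ f r)
    (hσ : ∃ σ : ℝ, 1 < σ ∧ IsBoundedUnder (· ≤ ·) (nhdsWithin (0:ℝ) (Ioi 0))
      (fun r => f r * |log r| ^ σ))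
    :
    ∃ C > (0:ℝ), ∃ ρ ∈ Ioo (0:ℝ) 1, ∀ v v' : ℝ → ℝ, MemX1 N k v v' →
      normX1 N k v' = 1 → ∀ r ∈ Ioc (0:ℝ) ρ,
        exp (muN N k * |v r| ^ (((N : ℝ) + 2) / N) * (|v r| ^ (f r) - 1)) ≤ C := by
  subst hN
  obtain ⟨σ, hσ1, M, hM⟩ := hσ
  obtain ⟨ε, hε, hεM⟩ := mem_nhdsGT_iff_exists_Ioc_subset.1 (eventually_map.1 hM)
  have hk' : (0 : ℝ) < k := by exact_mod_cast hk
  set D := 1 + (cN (2 * k) k)⁻¹ with hD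
  have hD1 : 1 ≤ D := by
    have : 0 ≤ (cN (2 * k) k)⁻¹ := by
      unfold cN omegaS
      positivity
    linarith
  have hμ : 0 ≤ muN (2 * k) k := by
    unfold muN omegaS
    positivity
  set p : ℝ := (((2 * k : ℕ) : ℝ) + 2) / ((2 * k : ℕ) : ℝ) with hp
  have hp0 : 0 ≤ p := by positivity
  have hkp : (k : ℝ) / (k + 1) * p = 1 := by
    rw [hp]
    push_cast
    field_simp
  set B := D ^ p * (max M 0 * D ^ (σ - 1) / (σ - 1)) * exp (max M 0 * D ^ (σ - 1) / (σ - 1))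
  refine ⟨exp (muN (2 * k) k * B), Real.exp_pos _, min ε (exp (-1)),
    ⟨lt_min hε (Real.exp_pos _), (min_le_right _ _).trans_lt (by simp)⟩, ?_⟩
  intro v v' hv hnorm r ⟨hr0, hr⟩
  have hre : r ≤ exp (-1) := hr.trans (min_le_right _ _)
  have hr1 : r < 1 := hre.trans_lt (by simp)
  have hL : 1 ≤ |log r| := by
    rw [abs_of_neg (Real.log_neg hr0 hr1)]
    have := (Real.log_le_log hr0 hre).trans_eq (Real.log_exp _)
    linarith
  have hfM : f r * |log r| ^ σ ≤ max M 0 :=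
    (hεM ⟨hr0, hr.trans (min_le_left _ _)⟩ : f r * |log r| ^ σ ≤ M).trans (le_max_left _ _)
  have hvr := hv.abs_le_rpow hnorm ⟨hr0, hr1⟩
  have hvL : |v r| ≤ D * |log r| := by
    refine hvr.trans (mul_le_mul_of_nonneg_left ?_ (by linarith))
    refine (Real.rpow_le_rpow_of_exponent_le hL ?_).trans_eq (Real.rpow_one _)
    rw [div_le_one (by positivity)]
    linarith
  have hvp : |v r| ^ p ≤ D ^ p * |log r| := by
    refine (Real.rpow_le_rpow (abs_nonneg _) hvr hp0).trans_eq ?_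
    rw [Real.mul_rpow (by linarith) (by positivity), ← Real.rpow_mul (by positivity), hkp,
      Real.rpow_one]
  have hmain := rpow_mul_rpow_sub_one_le hσ1 (le_max_right M 0) hD1 hL
    (hfnn r ⟨hr0.le, hr1⟩) hfM (abs_nonneg (v r)) hvL hvp
  rw [mul_assoc]
  exact Real.exp_le_exp.2 (mul_le_mul_of_nonneg_left hmain hμ)
end

section
/- For every real p ≥ 2 and every z > 0, ∫₀^z s^{p−1}/(1+s)^p ds = ln(1+z) − (γ + Ψ(p)) + ∫_{z/(1+z)}^1 (1 − s^{p−1})/(1−s) ds, where Ψ(p) = Γ'(p)/Γ(p) is the digamma function and γ is the Euler–Mascheroni constant. -/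
open MeasureTheory Real Set Filter
open scoped ENNReal

/-- The digamma function `Ψ(x) = Γ'(x)/Γ(x)`. -/
noncomputable def digamma (x : ℝ) : ℝ := deriv Real.Gamma x / Real.Gamma x

/-- The Euler–Mascheroni constant `γ = -Ψ(1)`. -/
noncomputable def eulerGamma : ℝ := -digamma 1

theorem digamma_add_one {x : ℝ} (hx : 0 < x) : digamma (x + 1) = digamma x + 1 / x := by
  have hd : ∀ y : ℝ, 0 < y → DifferentiableAt ℝ Real.Gamma y := fun y hy =>
    differentiableOn_Gamma_Ioi.differentiableAt (Ioi_mem_nhds hy)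
  have h1 : deriv (fun y => Real.Gamma (y + 1)) x = deriv Real.Gamma (x + 1) :=
    deriv_comp_add_const Real.Gamma 1 x
  have h2 : deriv (fun y => Real.Gamma (y + 1)) x = deriv (fun y => y * Real.Gamma y) x := by
    apply Filter.EventuallyEq.deriv_eq
    filter_upwards [Ioi_mem_nhds hx] with y hy
    exact Real.Gamma_add_one (ne_of_gt hy)
  have h3 : deriv (fun y => y * Real.Gamma y) x = 1 * Real.Gamma x + x * deriv Real.Gamma x :=
    ((hasDerivAt_id' x).mul (hd x hx).hasDerivAt).deriv
  have hG : Real.Gamma x ≠ 0 := (Real.Gamma_pos_of_pos hx).ne'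
  have hx' : x ≠ 0 := hx.ne'
  unfold digamma
  rw [← h1, h2, h3, Real.Gamma_add_one hx']
  field_simp
  ring

theorem monotoneOn_digamma : MonotoneOn digamma (Ioi 0) := by
  have hd : ∀ y ∈ Ioi (0 : ℝ), HasDerivAt (log ∘ Real.Gamma) (digamma y) y := fun y hy =>
    (differentiableOn_Gamma_Ioi.differentiableAt (Ioi_mem_nhds hy)).hasDerivAt.log
      (Real.Gamma_pos_of_pos hy).ne'
  have h := convexOn_log_Gamma.monotoneOn_deriv fun y hy => (hd y hy).differentiableAt
  intro x hx y hy hxy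
  simpa only [(hd x hx).deriv, (hd y hy).deriv] using h hx hy hxy

/-- A monotone solution of `f (x + 1) = f x + 1 / x` on `[1, ∞)` is determined by `f 1`. -/
theorem eq_of_monotoneOn_of_add_one {f g : ℝ → ℝ} (hf : MonotoneOn f (Ici 1))
    (hg : MonotoneOn g (Ici 1)) (hf1 : ∀ x, 1 ≤ x → f (x + 1) = f x + 1 / x)
    (hg1 : ∀ x, 1 ≤ x → g (x + 1) = g x + 1 / x) (h1 : f 1 = g 1) {x : ℝ} (hx : 1 ≤ x) :
    f x = g x := by
  have hper : ∀ y : ℝ, 1 ≤ y → ∀ n : ℕ, f (y + n) - g (y + n) = f y - g y := by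
    intro y hy n
    induction n with
    | zero => simp
    | succ k ih =>
      have hk : 1 ≤ y + k := by have : (0 : ℝ) ≤ k := k.cast_nonneg; linarith
      push_cast
      rw [← add_assoc, hf1 _ hk, hg1 _ hk]
      linarith
  have hbound : ∀ n : ℕ, |f x - g x| ≤ 1 / ((n : ℝ) + 1) := by
    intro n
    obtain ⟨m, hm⟩ : ∃ m : ℕ, ⌊x⌋₊ = m + 1 :=
      Nat.exists_eq_succ_of_ne_zero (Nat.floor_pos.2 hx).ne'
    have hle : (1 : ℝ) + m ≤ x := by
      have := Nat.floor_le (zero_le_one.trans hx)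
      rw [hm] at this; push_cast at this; linarith
    have hlt : x < 1 + m + 1 := by
      have := Nat.lt_floor_add_one x
      rw [hm] at this; push_cast at this; linarith
    have hm0 : (0 : ℝ) ≤ m := m.cast_nonneg
    have hn0 : (0 : ℝ) ≤ n := n.cast_nonneg
    have ha : (1 : ℝ) ≤ 1 + (m + n : ℕ) := by push_cast; linarith
    have hxn : (1 : ℝ) ≤ x + n := by linarith
    have hd := hper 1 le_rfl (m + n)
    have hdx := hper x hx n
    have hlo : 1 + ((m + n : ℕ) : ℝ) ≤ x + n := by push_cast; linarith
    have hhi : x + n ≤ 1 + ((m + n : ℕ) : ℝ) + 1 := by push_cast; linarith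
    have ha' : (1 : ℝ) ≤ 1 + ((m + n : ℕ) : ℝ) + 1 := by linarith
    have f1 := hf ha hxn hlo
    have f2 := hf hxn ha' hhi
    have g1 := hg ha hxn hlo
    have g2 := hg hxn ha' hhi
    rw [hf1 _ ha] at f2
    rw [hg1 _ ha] at g2
    have hfrac : 1 / (1 + ((m + n : ℕ) : ℝ)) ≤ 1 / ((n : ℝ) + 1) := by
      apply one_div_le_one_div_of_le (by linarith)
      push_cast; linarith
    rw [abs_le]
    constructor <;> linarith
  have h0 : |f x - g x| ≤ 0 := ge_of_tendsto' tendsto_one_div_add_atTop_nhds_zero_nat hbound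
  exact sub_eq_zero.1 (abs_nonpos_iff.1 h0)

theorem one_sub_rpow_div_one_sub_mem_Icc {q t : ℝ} (hq : 0 ≤ q) (ht : t ∈ Icc (0 : ℝ) 1) :
    (1 - t ^ q) / (1 - t) ∈ Icc 0 (q + 1) := by
  obtain ⟨h0, h1⟩ := ht
  rcases h1.eq_or_lt with rfl | hlt
  · simp; linarith
  have hpos : 0 < 1 - t := sub_pos.2 hlt
  refine ⟨div_nonneg (sub_nonneg.2 (rpow_le_one h0 h1 hq)) hpos.le, ?_⟩
  rw [div_le_iff₀ hpos]
  have hB := one_add_mul_self_le_rpow_one_add (s := t - 1) (by linarith) (p := q + 1) (by linarith)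
  rw [add_sub_cancel] at hB
  have hmono : t ^ (q + 1) ≤ t ^ q := by
    rw [rpow_add_one' h0 (by linarith)]
    exact mul_le_of_le_one_right (rpow_nonneg h0 q) h1
  linarith

theorem intervalIntegrable_one_sub_rpow_div_one_sub {q a b : ℝ} (hq : 0 ≤ q)
    (ha : a ∈ Icc (0 : ℝ) 1) (hb : b ∈ Icc (0 : ℝ) 1) :
    IntervalIntegrable (fun t : ℝ => (1 - t ^ q) / (1 - t)) volume a b := by
  have hsub : uIcc a b ⊆ Icc 0 1 := by
    rw [← uIcc_of_le (zero_le_one' ℝ)] at ha hb ⊢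
    exact uIcc_subset_uIcc ha hb
  refine (intervalIntegrable_const (c := q + 1)).mono_fun'
    (Measurable.aestronglyMeasurable (by fun_prop)) ?_
  refine (ae_restrict_iff' measurableSet_uIoc).2 (Eventually.of_forall fun t ht => ?_)
  have h := one_sub_rpow_div_one_sub_mem_Icc hq (hsub (uIoc_subset_uIcc ht))
  simpa only [Real.norm_eq_abs, abs_of_nonneg h.1] using h.2

/-- The **Gauss integral representation** of the digamma function on `[1, ∞)`. -/
theorem integral_one_sub_rpow_div_one_sub {p : ℝ} (hp : 1 ≤ p) :
    ∫ t in (0 : ℝ)..1, (1 - t ^ (p - 1)) / (1 - t) = eulerGamma + digamma p := by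
  have hint : ∀ x : ℝ, 1 ≤ x →
      IntervalIntegrable (fun t : ℝ => (1 - t ^ (x - 1)) / (1 - t)) volume 0 1 := fun x hx =>
    intervalIntegrable_one_sub_rpow_div_one_sub (by linarith) (by simp) (by simp)
  refine eq_of_monotoneOn_of_add_one
    (f := fun x => ∫ t in (0 : ℝ)..1, (1 - t ^ (x - 1)) / (1 - t))
    (g := fun x => eulerGamma + digamma x) ?_ ?_ ?_ ?_ ?_ hp
  · intro x hx y hy hxy
    refine intervalIntegral.integral_mono_on_of_le_Ioo zero_le_one (hint x hx) (hint y hy) ?_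
    intro t ht
    have := rpow_le_rpow_of_exponent_ge ht.1 ht.2.le (sub_le_sub_right hxy 1)
    have := ht.2
    exact div_le_div_of_nonneg_right (by linarith) (by linarith)
  · intro x hx y hy hxy
    have h := monotoneOn_digamma (mem_Ioi.2 (zero_lt_one.trans_le hx))
      (mem_Ioi.2 (zero_lt_one.trans_le hy)) hxy
    simpa using h
  · intro x hx
    have hpow : ∫ t in (0 : ℝ)..1, t ^ (x - 1) = 1 / x := by
      rw [integral_rpow (Or.inl (by linarith)), sub_add_cancel, one_rpow,
        zero_rpow (by linarith), sub_zero]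
    rw [← sub_eq_iff_eq_add', ← intervalIntegral.integral_sub (hint _ (by linarith)) (hint x hx),
      ← hpow]
    refine intervalIntegral.integral_congr_Ioo_of_le zero_le_one fun t ht => ?_
    have h1 : 1 - t ≠ 0 := (sub_pos.2 ht.2).ne'
    have hr : t ^ (x + 1 - 1) = t ^ (x - 1) * t := by
      rw [← rpow_add_one ht.1.ne']; ring_nf
    simp only [hr]
    field_simp
    ring
  · intro x hx
    simp only [digamma_add_one (zero_lt_one.trans_le hx), add_assoc]
  · simp [eulerGamma]

theorem integral_rpow_div_one_add_rpow {p z : ℝ} (hp : 1 ≤ p) (hz : 0 ≤ z) :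
    ∫ s in (0 : ℝ)..z, s ^ (p - 1) / (1 + s) ^ p =
      ∫ t in (0 : ℝ)..(z / (1 + z)), t ^ (p - 1) / (1 - t) := by
  have hd : ∀ s ∈ uIcc 0 z, HasDerivAt (fun s : ℝ => s / (1 + s)) (1 / (1 + s) ^ 2) s := by
    intro s hs
    rw [uIcc_of_le hz] at hs
    have h1 : 1 + s ≠ 0 := by linarith [hs.1]
    refine ((hasDerivAt_id' s).fun_div ((hasDerivAt_id' s).const_add 1) h1).congr_deriv ?_
    ring
  have hsub := intervalIntegral.integral_comp_mul_deriv' (a := 0) (b := z)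
    (f := fun s : ℝ => s / (1 + s)) (f' := fun s => 1 / (1 + s) ^ 2)
    (g := fun t => t ^ (p - 1) / (1 - t)) hd ?_ ?_
  · simp only [zero_div] at hsub
    rw [← hsub]
    refine intervalIntegral.integral_congr fun s hs => ?_
    rw [uIcc_of_le hz] at hs
    have h0 : 0 ≤ s := hs.1
    have h1 : 0 < 1 + s := by linarith
    have h2 : 1 - s / (1 + s) = 1 / (1 + s) := by field_simp; ring
    simp only [Function.comp_apply]
    rw [h2, div_rpow h0 h1.le, rpow_sub_one h1.ne' p]
    have h3 : (1 + s) ^ p ≠ 0 := (rpow_pos_of_pos h1 p).ne'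
    field_simp
  · refine ContinuousOn.div (by fun_prop) (by fun_prop) fun s hs => ?_
    rw [uIcc_of_le hz] at hs
    have := hs.1
    positivity
  · refine ContinuousOn.div
      ((continuous_id.rpow_const fun _ => Or.inr (by linarith)).continuousOn) (by fun_prop) ?_
    rintro _ ⟨s, hs, rfl⟩
    rw [uIcc_of_le hz] at hs
    have h1 : 0 < 1 + s := by linarith [hs.1]
    have h2 : 1 - s / (1 + s) = 1 / (1 + s) := by field_simp; ring
    rw [h2]
    positivity

theorem stmt9 (p z : ℝ) (hp : 2 ≤ p) (hz : 0 < z) :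
    ∫ s in (0:ℝ)..z, s ^ (p - 1) / (1 + s) ^ p =
      log (1 + z) - (eulerGamma + digamma p) +
        ∫ s in (z / (1 + z))..1, (1 - s ^ (p - 1)) / (1 - s) := by
  have hp1 : 1 ≤ p := by linarith
  have h1z : 0 < 1 + z := by linarith
  set w := z / (1 + z) with hw
  have hw0 : 0 ≤ w := by positivity
  have hw1 : 1 - w = 1 / (1 + z) := by rw [hw]; field_simp; ring
  have hwlt : 0 < 1 - w := by rw [hw1]; positivity
  have hwm : w ∈ Icc (0 : ℝ) 1 := ⟨hw0, by linarith⟩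
  have hlog : ∫ t in (0 : ℝ)..w, 1 / (1 - t) = log (1 + z) := by
    rw [intervalIntegral.integral_comp_sub_left (fun t => 1 / t) 1, sub_zero,
      integral_one_div_of_pos hwlt one_pos, hw1, one_div_one_div]
  have hi1 : IntervalIntegrable (fun t : ℝ => 1 / (1 - t)) volume 0 w := by
    refine ContinuousOn.intervalIntegrable (ContinuousOn.div (by fun_prop) (by fun_prop) ?_)
    intro t ht
    rw [uIcc_of_le hw0] at ht
    linarith [ht.2]
  have hi2 := intervalIntegrable_one_sub_rpow_div_one_sub (q := p - 1) (a := 0) (b := w)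
    (by linarith) (by simp) hwm
  have hi3 := intervalIntegrable_one_sub_rpow_div_one_sub (q := p - 1) (a := w) (b := 1)
    (by linarith) hwm (by simp)
  have hsplit : ∫ t in (0 : ℝ)..w, t ^ (p - 1) / (1 - t) =
      log (1 + z) - ∫ t in (0 : ℝ)..w, (1 - t ^ (p - 1)) / (1 - t) := by
    rw [← hlog, ← intervalIntegral.integral_sub hi1 hi2]
    congr 1
    ext t
    ring
  rw [integral_rpow_div_one_add_rpow hp1 hz.le, hsplit, ← integral_one_sub_rpow_div_one_sub hp1,
    ← intervalIntegral.integral_add_adjacent_intervals hi2 hi3]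
  ring
end
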